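/- Every graph cycle A ∈ C is a path cycle; that is, A is either a singleton or a connected subset of S with max_A H < min_{∂A} H. -/

import Mathlib

open scoped ENNReal

namespace MetropolisCycles

variable {S : Type*} [Fintype S] [DecidableEq S]

/-- A path: a finite sequence of states whose consecutive members communicate. -/
def IsPath (q : S → S → ℝ) (ω : List S) : Prop :=
  ω.Chain' (fun a b => 0 < q a b)

/-- `x` and `y` are joined by a path entirely contained in `G`. -/
def JoinedIn (q : S → S → ℝ) (G : Set S) (x y : S) : Prop :=
  ∃ ω : List S, ω.head? = some x ∧ ω.getLast? = some y ∧ IsPath q ω ∧ ∀ z ∈ ω, z ∈ G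

/-- `G` is connected: any two of its points are joined by a path inside `G`. -/
def IsConnectedSet (q : S → S → ℝ) (G : Set S) : Prop :=
  ∀ x ∈ G, ∀ y ∈ G, JoinedIn q G x y

/-- The exterior boundary `∂G`. -/
def extBoundary (q : S → S → ℝ) (G : Set S) : Set S :=
  {y | y ∉ G ∧ ∃ x ∈ G, 0 < q x y}

/-- `A` is a non-trivial path cycle: connected and `max_A H < min_{∂A} H`. -/
def IsNontrivialPathCycle (H : S → ℝ) (q : S → S → ℝ) (A : Set S) : Prop :=
  A.Nonempty ∧ IsConnectedSet q A ∧ ∀ x ∈ A, ∀ y ∈ extBoundary q A, H x < H y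

/-- `A` is a path cycle: a singleton or a non-trivial path cycle. -/
def IsPathCycle (H : S → ℝ) (q : S → S → ℝ) (A : Set S) : Prop :=
  (∃ x, A = {x}) ∨ IsNontrivialPathCycle H q A

/-- The set of points joined to `x` by a path whose points all have energy at most `c`. -/
def energyCut (H : S → ℝ) (q : S → S → ℝ) (c : ℝ) (x : S) : Set S :=
  {y | JoinedIn q {z | H z ≤ c} x y}

/-- `U_{≤ x}`: the points joined to `x` by a path with energies at most `H x`. -/
def Ule (H : S → ℝ) (q : S → S → ℝ) (x : S) : Set S := energyCut H q (H x) x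

/-- The total cost of a path of cycles with respect to a cost function `Vs`. -/
noncomputable def listCost (Vs : Set S → Set S → ℝ≥0∞) : List (Set S) → ℝ≥0∞
  | [] => 0
  | [_] => 0
  | B :: B' :: l => Vs B B' + listCost Vs (B' :: l)

/-- `H_e` relative to a level `(E, V)` of the construction:
`H_e(A) = min { V(A,A') : A' ∈ E, A' ≠ A }`. -/
noncomputable def HeAux (E : Set (Set S)) (V : Set S → Set S → ℝ≥0∞) (A : Set S) : ℝ≥0∞ :=
  ⨅ A' ∈ E \ {A}, V A A'

/-- The renormalized cost function `V_* (A,B) = V(A,B) - H_e(A)`. -/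
noncomputable def VsAux (E : Set (Set S)) (V : Set S → Set S → ℝ≥0∞) (A B : Set S) : ℝ≥0∞ :=
  V A B - HeAux E V A

/-- `A →_k A'`: some path of elements of `E` from `A` to `A'` has zero total `V_*`-cost. -/
def arrowAux (E : Set (Set S)) (V : Set S → Set S → ℝ≥0∞) (A A' : Set S) : Prop :=
  ∃ l : List (Set S), l.head? = some A ∧ l.getLast? = some A' ∧ (∀ B ∈ l, B ∈ E) ∧
    listCost (VsAux E V) l = 0

/-- The set `D^{k+1}`: unions of the `R_k`-equivalence classes. -/
def DAux (E : Set (Set S)) (V : Set S → Set S → ℝ≥0∞) : Set (Set S) :=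
  {B | ∃ A ∈ E, B = ⋃₀ {A' | A' ∈ E ∧ arrowAux E V A A' ∧ arrowAux E V A' A}}

/-- The order relation `≥^{k+1}` on `D^{k+1}`. -/
def geqAux (E : Set (Set S)) (V : Set S → Set S → ℝ≥0∞) (B B' : Set S) : Prop :=
  ∃ C ∈ E, ∃ C' ∈ E, C ⊆ B ∧ C' ⊆ B' ∧ arrowAux E V C C'

/-- `D_*^{k+1}`: the minimal elements of `D^{k+1}` for `≥^{k+1}`. -/
def DstarAux (E : Set (Set S)) (V : Set S → Set S → ℝ≥0∞) : Set (Set S) :=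
  {B ∈ DAux E V | ∀ B' ∈ DAux E V, geqAux E V B B' → B' = B}

/-- `E^{k+1}` built from `(E^k, V^k)`. -/
def EnextAux (E : Set (Set S)) (V : Set S → Set S → ℝ≥0∞) : Set (Set S) :=
  DstarAux E V ∪ {A | A ∈ E ∧ ∃ B ∈ DAux E V \ DstarAux E V, A ⊆ B}

/-- `H_m^{k+1}(A) = max { H_e^k(A') : A' ∈ E^k, A' ⊆ A }`. -/
noncomputable def HmAux (E : Set (Set S)) (V : Set S → Set S → ℝ≥0∞) (A : Set S) : ℝ≥0∞ :=
  ⨆ A' ∈ {A' | A' ∈ E ∧ A' ⊆ A}, HeAux E V A'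

/-- `V^{k+1}(A,A') = H_m^{k+1}(A) + min { V_*^k(B,B') : B,B' ∈ E^k, B ⊆ A, B' ⊆ A' }`. -/
noncomputable def VnextAux (E : Set (Set S)) (V : Set S → Set S → ℝ≥0∞) (A A' : Set S) : ℝ≥0∞ :=
  HmAux E V A + ⨅ B ∈ {B | B ∈ E ∧ B ⊆ A}, ⨅ B' ∈ {B' | B' ∈ E ∧ B' ⊆ A'}, VsAux E V B B'

/-- The zero-order cost function `V^0({i},{j}) = (H j - H i)⁺` if `q i j > 0`, `∞` otherwise
(and `∞` on non-singletons). -/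
noncomputable def V0 (H : S → ℝ) (q : S → S → ℝ) (A B : Set S) : ℝ≥0∞ :=
  ⨅ i ∈ A, ⨅ j ∈ B, ⨅ _ : A = {i} ∧ B = {j} ∧ 0 < q i j, ENNReal.ofReal (H j - H i)

/-- The recursive construction `k ↦ (E^k, V^k)`. -/
noncomputable def cycEV (H : S → ℝ) (q : S → S → ℝ) : ℕ → Set (Set S) × (Set S → Set S → ℝ≥0∞)
  | 0 => ({A | ∃ i, A = {i}}, V0 H q)
  | k + 1 => (EnextAux (cycEV H q k).1 (cycEV H q k).2,
              VnextAux (cycEV H q k).1 (cycEV H q k).2)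

/-- The `k`-th order set of graph cycles `E^k`. -/
noncomputable def Ecyc (H : S → ℝ) (q : S → S → ℝ) (k : ℕ) : Set (Set S) := (cycEV H q k).1

/-- The `k`-th order cost function `V^k`. -/
noncomputable def Vcyc (H : S → ℝ) (q : S → S → ℝ) (k : ℕ) : Set S → Set S → ℝ≥0∞ :=
  (cycEV H q k).2

/-- `H_e^k(A)`. -/
noncomputable def Hek (H : S → ℝ) (q : S → S → ℝ) (k : ℕ) (A : Set S) : ℝ≥0∞ :=
  HeAux (Ecyc H q k) (Vcyc H q k) A

/-- `H_m^k(A)` (defined for `k ≥ 1`; set to `0` at `k = 0`). -/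
noncomputable def Hmk (H : S → ℝ) (q : S → S → ℝ) : ℕ → Set S → ℝ≥0∞
  | 0 => fun _ => 0
  | k + 1 => fun A => HmAux (Ecyc H q k) (Vcyc H q k) A

/-- `D^{n+1}` (indexed by `n`). -/
noncomputable def Dcyc (H : S → ℝ) (q : S → S → ℝ) (n : ℕ) : Set (Set S) :=
  DAux (Ecyc H q n) (Vcyc H q n)

/-- `D_*^{n+1}` (indexed by `n`). -/
noncomputable def DstarCyc (H : S → ℝ) (q : S → S → ℝ) (n : ℕ) : Set (Set S) :=
  DstarAux (Ecyc H q n) (Vcyc H q n)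

/-- The set of graph cycles `C = ∪_k E^k`. -/
def GraphCycles (H : S → ℝ) (q : S → S → ℝ) : Set (Set S) := {A | ∃ k, A ∈ Ecyc H q k}

/-- `H_e(A) = sup { H_e^k(A) : k ≥ 0, A ∈ E^k }` (for a graph cycle `A ≠ S`). -/
noncomputable def HeC (H : S → ℝ) (q : S → S → ℝ) (A : Set S) : ℝ≥0∞ :=
  ⨆ k, ⨆ _ : A ∈ Ecyc H q k, Hek H q k A

/-- `H_m(A) = max( sup { H_e(B) : B ∈ C, B ⊆ A, B ≠ A }, 0 )` (for `|A| > 1`). -/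
noncomputable def HmC (H : S → ℝ) (q : S → S → ℝ) (A : Set S) : ℝ≥0∞ :=
  ⨆ B ∈ {B | B ∈ GraphCycles H q ∧ B ⊆ A ∧ B ≠ A}, HeC H q B

section Chains

variable {α : Type*}

/-- A chain inside `P` from `a` to `b` amounts to a reflexive-transitive closure. -/
theorem exists_isChain_iff_reflTransGen {R : α → α → Prop} {P : α → Prop} {a b : α} :
    (∃ l : List α, l.head? = some a ∧ l.getLast? = some b ∧ l.IsChain R ∧ ∀ z ∈ l, P z) ↔
      P a ∧ Relation.ReflTransGen (fun x y => R x y ∧ P x ∧ P y) a b := by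
  constructor
  · rintro ⟨l, hhead, hlast, hchain, hP⟩
    induction l generalizing a with
    | nil => simp at hhead
    | cons x l ih =>
      obtain rfl : x = a := by simpa using hhead
      refine ⟨hP x (by simp), ?_⟩
      cases l with
      | nil =>
        obtain rfl : x = b := by simpa using hlast
        exact .refl
      | cons y l =>
        rw [List.isChain_cons_cons] at hchain
        have h := ih (a := y) rfl (by simpa using hlast) hchain.2
          (fun z hz => hP z (List.mem_cons_of_mem _ hz))
        exact .head ⟨hchain.1, hP x (by simp), h.1⟩ h.2
  · rintro ⟨ha, h⟩
    induction h using Relation.ReflTransGen.head_induction_on with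
    | refl => exact ⟨[b], by simp [ha]⟩
    | @head x y hxy _ ih =>
      obtain ⟨l, hhead, hlast, hchain, hP⟩ := ih hxy.2.2
      cases l with
      | nil => simp at hhead
      | cons z l =>
        obtain rfl : z = y := by simpa using hhead
        refine ⟨x :: z :: l, rfl, by simpa using hlast, ?_, ?_⟩
        · exact List.isChain_cons_cons.2 ⟨hxy.1, hchain⟩
        · intro w hw
          rcases List.mem_cons.1 hw with rfl | hw
          exacts [ha, hP w hw]

theorem joinedIn_iff {q : α → α → ℝ} {G : Set α} {x y : α} :
    JoinedIn q G x y ↔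
      x ∈ G ∧ Relation.ReflTransGen (fun a b => 0 < q a b ∧ a ∈ G ∧ b ∈ G) x y :=
  exists_isChain_iff_reflTransGen

theorem JoinedIn.trans {q : α → α → ℝ} {G : Set α} {x y z : α}
    (h : JoinedIn q G x y) (h' : JoinedIn q G y z) : JoinedIn q G x z := by
  rw [joinedIn_iff] at *
  exact ⟨h.1, h.2.trans h'.2⟩

theorem JoinedIn.mono {q : α → α → ℝ} {G G' : Set α} {x y : α}
    (h : JoinedIn q G x y) (hG : G ⊆ G') : JoinedIn q G' x y := by
  obtain ⟨l, h1, h2, h3, h4⟩ := h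
  exact ⟨l, h1, h2, h3, fun z hz => hG (h4 z hz)⟩

theorem joinedIn_of_edge {q : α → α → ℝ} {G : Set α} {x y : α}
    (hxy : 0 < q x y) (hx : x ∈ G) (hy : y ∈ G) : JoinedIn q G x y :=
  joinedIn_iff.2 ⟨hx, .single ⟨hxy, hx, hy⟩⟩

/-- A path leaving a set crosses its boundary. -/
theorem JoinedIn.exists_edge {q : α → α → ℝ} {G A : Set α} {x y : α}
    (h : JoinedIn q G x y) (hx : x ∈ A) (hy : y ∉ A) : ∃ u ∈ A, ∃ v ∉ A, 0 < q u v := by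
  by_contra! hcon
  apply hy
  induction (joinedIn_iff.1 h).2 with
  | refl => exact hx
  | @tail u v _ huv ih =>
    by_contra hv
    by_cases hu : u ∈ A
    · exact absurd huv.1 (not_lt.2 (hcon u hu v hv))
    · exact hu (ih (joinedIn_iff.2 ⟨(joinedIn_iff.1 h).1, by assumption⟩) hu)

theorem listCost_eq_zero_iff {Vs : Set α → Set α → ℝ≥0∞} {l : List (Set α)} :
    listCost Vs l = 0 ↔ l.IsChain (fun A B => Vs A B = 0) := by
  induction l with
  | nil => simp [listCost]
  | cons A l ih => cases l <;> simp_all [listCost]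

theorem arrowAux_iff {E : Set (Set α)} {V : Set α → Set α → ℝ≥0∞} {A B : Set α} :
    arrowAux E V A B ↔
      A ∈ E ∧ Relation.ReflTransGen (fun X Y => VsAux E V X Y = 0 ∧ X ∈ E ∧ Y ∈ E) A B := by
  rw [← exists_isChain_iff_reflTransGen]
  simp only [arrowAux, listCost_eq_zero_iff]
  exact exists_congr fun l => by tauto

theorem arrowAux.trans {E : Set (Set α)} {V : Set α → Set α → ℝ≥0∞} {A B C : Set α}
    (h : arrowAux E V A B) (h' : arrowAux E V B C) : arrowAux E V A C := by
  rw [arrowAux_iff] at *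
  exact ⟨h.1, h.2.trans h'.2⟩

theorem arrowAux_refl {E : Set (Set α)} (V : Set α → Set α → ℝ≥0∞) {A : Set α} (hA : A ∈ E) :
    arrowAux E V A A :=
  arrowAux_iff.2 ⟨hA, .refl⟩

theorem arrowAux_of_VsAux_eq_zero {E : Set (Set α)} {V : Set α → Set α → ℝ≥0∞} {A B : Set α}
    (hA : A ∈ E) (hB : B ∈ E) (h : VsAux E V A B = 0) : arrowAux E V A B :=
  arrowAux_iff.2 ⟨hA, .single ⟨h, hA, hB⟩⟩

end Chains

section Heights

variable {α : Type*}

/-- The lowest height at which one can step from `A` to `B`. -/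
noncomputable def passHeight (q : α → α → ℝ) (h : α → ℝ≥0∞) (A B : Set α) : ℝ≥0∞ :=
  ⨅ x ∈ A, ⨅ y ∈ B, ⨅ _ : 0 < q x y, max (h x) (h y)

/-- The height of the bottom of `A`. -/
noncomputable def bottom (h : α → ℝ≥0∞) (A : Set α) : ℝ≥0∞ := ⨅ x ∈ A, h x

/-- The lowest height at which one can step from `A` to another element of `E`. -/
noncomputable def exitHeight (q : α → α → ℝ) (h : α → ℝ≥0∞) (E : Set (Set α)) (A : Set α) :
    ℝ≥0∞ :=
  ⨅ B ∈ E \ {A}, passHeight q h A B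

theorem passHeight_le {q : α → α → ℝ} (h : α → ℝ≥0∞) {A B : Set α} {x y : α}
    (hx : x ∈ A) (hy : y ∈ B) (hxy : 0 < q x y) : passHeight q h A B ≤ max (h x) (h y) :=
  iInf₂_le_of_le x hx <| iInf₂_le_of_le y hy <| iInf_le _ hxy

theorem le_passHeight {q : α → α → ℝ} {h : α → ℝ≥0∞} {A B : Set α} {c : ℝ≥0∞}
    (H : ∀ x ∈ A, ∀ y ∈ B, 0 < q x y → c ≤ max (h x) (h y)) : c ≤ passHeight q h A B :=
  le_iInf₂ fun x hx => le_iInf₂ fun y hy => le_iInf fun hxy => H x hx y hy hxy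

theorem passHeight_comm {q : α → α → ℝ} (hsym : ∀ x y, q x y = q y x) (h : α → ℝ≥0∞)
    (A B : Set α) : passHeight q h A B = passHeight q h B A := by
  apply le_antisymm <;> refine le_passHeight fun x hx y hy hxy => ?_ <;>
  · rw [max_comm]
    exact passHeight_le h hy hx (hsym x y ▸ hxy)

theorem exists_edge_of_passHeight_ne_top {q : α → α → ℝ} {h : α → ℝ≥0∞} {A B : Set α}
    (H : passHeight q h A B ≠ ⊤) : ∃ x ∈ A, ∃ y ∈ B, 0 < q x y := by
  by_contra! hcon
  exact H (top_le_iff.1 (le_passHeight fun x hx y hy hxy =>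
    absurd hxy (not_lt.2 (hcon x hx y hy))))

theorem exitHeight_le_passHeight {q : α → α → ℝ} {h : α → ℝ≥0∞} {E : Set (Set α)} {A B : Set α}
    (hB : B ∈ E) (hAB : A ≠ B) : exitHeight q h E A ≤ passHeight q h A B :=
  iInf₂_le B ⟨hB, hAB.symm⟩

theorem bottom_ne_top {h : α → ℝ≥0∞} (hfin : ∀ x, h x ≠ ⊤) {A : Set α} (hA : A.Nonempty) :
    bottom h A ≠ ⊤ := by
  obtain ⟨x, hx⟩ := hA
  exact ne_top_of_le_ne_top (hfin x) (iInf₂_le x hx)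

/-- The properties shared by all levels of the cycle decomposition. -/
structure IsCycleLevel (H : α → ℝ) (q : α → α → ℝ) (h : α → ℝ≥0∞) (E : Set (Set α))
    (V : Set α → Set α → ℝ≥0∞) : Prop where
  nonempty : ∀ A ∈ E, A.Nonempty
  cover : ∀ x, ∃ A ∈ E, x ∈ A
  eq_of_mem : ∀ A ∈ E, ∀ B ∈ E, ∀ x, x ∈ A → x ∈ B → A = B
  isPathCycle : ∀ A ∈ E, IsPathCycle H q A
  cost : ∀ A ∈ E, ∀ B ∈ E, A ≠ B → V A B + bottom h A = passHeight q h A B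

theorem IsPathCycle.isConnectedSet {H : α → ℝ} {q : α → α → ℝ} {A : Set α}
    (hA : IsPathCycle H q A) : IsConnectedSet q A := by
  rcases hA with ⟨x, rfl⟩ | hA
  · rintro y rfl z rfl
    exact joinedIn_iff.2 ⟨rfl, .refl⟩
  · exact hA.2.1

end Heights

section Level

variable {α : Type*} {H : α → ℝ} {q : α → α → ℝ} {h : α → ℝ≥0∞} {E : Set (Set α)}
  {V : Set α → Set α → ℝ≥0∞}

theorem IsPathCycle.le_passHeight (hmono : ∀ x y, h x ≤ h y ↔ H x ≤ H y) {A B : Set α}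
    (hA : IsPathCycle H q A) (hAB : Disjoint A B) {x : α} (hx : x ∈ A) :
    h x ≤ passHeight q h A B := by
  refine MetropolisCycles.le_passHeight fun u hu v hv huv => ?_
  rcases hA with ⟨y, rfl⟩ | hA
  · obtain rfl : x = y := hx
    obtain rfl : u = x := hu
    exact le_max_left _ _
  · refine le_max_of_le_right ((hmono x v).2 (hA.2.2 x hx v ⟨?_, u, hu, huv⟩).le)
    exact Set.disjoint_right.1 hAB hv

/-- The union of the equivalence class of `A`. -/
def arrowClass (E : Set (Set α)) (V : Set α → Set α → ℝ≥0∞) (A : Set α) : Set α :=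
  ⋃₀ {B | B ∈ E ∧ arrowAux E V A B ∧ arrowAux E V B A}

theorem subset_arrowClass {A B : Set α} (hB : B ∈ E) (hAB : arrowAux E V A B)
    (hBA : arrowAux E V B A) : B ⊆ arrowClass E V A :=
  Set.subset_sUnion_of_mem ⟨hB, hAB, hBA⟩

theorem arrowClass_mem_DAux {A : Set α} (hA : A ∈ E) : arrowClass E V A ∈ DAux E V :=
  ⟨A, hA, rfl⟩

theorem arrowClass_congr {A B : Set α} (hAB : arrowAux E V A B) (hBA : arrowAux E V B A) :
    arrowClass E V A = arrowClass E V B := by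
  unfold arrowClass
  congr 1
  ext C
  exact ⟨fun ⟨h1, h2, h3⟩ => ⟨h1, hBA.trans h2, h3.trans hAB⟩,
    fun ⟨h1, h2, h3⟩ => ⟨h1, hAB.trans h2, h3.trans hBA⟩⟩

namespace IsCycleLevel

theorem disjoint (L : IsCycleLevel H q h E V) {A B : Set α} (hA : A ∈ E) (hB : B ∈ E)
    (hAB : A ≠ B) : Disjoint A B :=
  Set.disjoint_left.2 fun x hxA hxB => hAB (L.eq_of_mem A hA B hB x hxA hxB)

theorem eq_of_subset (L : IsCycleLevel H q h E V) {A B : Set α} (hA : A ∈ E) (hB : B ∈ E)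
    (hAB : A ⊆ B) : A = B := by
  obtain ⟨x, hx⟩ := L.nonempty A hA
  exact L.eq_of_mem A hA B hB x hx (hAB hx)

theorem arrowAux_of_subset_arrowClass (L : IsCycleLevel H q h E V) {A B : Set α} (hB : B ∈ E)
    (hsub : B ⊆ arrowClass E V A) : arrowAux E V A B ∧ arrowAux E V B A := by
  obtain ⟨x, hx⟩ := L.nonempty B hB
  obtain ⟨C, ⟨hC, hAC, hCA⟩, hxC⟩ := hsub hx
  obtain rfl := L.eq_of_mem B hB C hC x hx hxC
  exact ⟨hAC, hCA⟩

theorem DAux_eq_of_mem (L : IsCycleLevel H q h E V) {A B : Set α} (hA : A ∈ DAux E V)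
    (hB : B ∈ DAux E V) {x : α} (hxA : x ∈ A) (hxB : x ∈ B) : A = B := by
  obtain ⟨A, -, rfl⟩ := hA
  obtain ⟨B, -, rfl⟩ := hB
  obtain ⟨C, ⟨hC, hAC, hCA⟩, hxC⟩ := hxA
  obtain ⟨D, ⟨hD, hBD, hDB⟩, hxD⟩ := hxB
  obtain rfl := L.eq_of_mem C hC D hD x hxC hxD
  exact arrowClass_congr (hAC.trans hDB) (hBD.trans hCA)

theorem HeAux_add_bottom (L : IsCycleLevel H q h E V) {A : Set α} (hA : A ∈ E) :
    HeAux E V A + bottom h A = exitHeight q h E A := by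
  simp only [HeAux, exitHeight, ENNReal.iInf_add]
  exact biInf_congr fun B hB => L.cost A hA B hB.1 (Ne.symm hB.2)

theorem VsAux_eq (L : IsCycleLevel H q h E V) (hfin : ∀ x, h x ≠ ⊤) {A B : Set α}
    (hA : A ∈ E) (hB : B ∈ E) (hAB : A ≠ B) :
    VsAux E V A B = passHeight q h A B - exitHeight q h E A := by
  rw [VsAux, ← L.HeAux_add_bottom hA, ← L.cost A hA B hB hAB,
    ENNReal.add_sub_add_eq_sub_right (bottom_ne_top hfin (L.nonempty A hA))]

theorem passHeight_le_exitHeight (L : IsCycleLevel H q h E V) (hfin : ∀ x, h x ≠ ⊤)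
    {A B : Set α} (hA : A ∈ E) (hB : B ∈ E) (hAB : A ≠ B) (hV : VsAux E V A B = 0) :
    passHeight q h A B ≤ exitHeight q h E A := by
  rwa [L.VsAux_eq hfin hA hB hAB, tsub_eq_zero_iff_le] at hV

theorem exitHeight_anti (L : IsCycleLevel H q h E V) (hfin : ∀ x, h x ≠ ⊤)
    (hsym : ∀ x y, q x y = q y x) {A B : Set α} (hAB : arrowAux E V A B) :
    exitHeight q h E B ≤ exitHeight q h E A := by
  induction (arrowAux_iff.1 hAB).2 with
  | refl => rfl
  | @tail X Y hX hXY ih =>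
    refine le_trans ?_ (ih (arrowAux_iff.2 ⟨(arrowAux_iff.1 hAB).1, hX⟩))
    rcases eq_or_ne X Y with rfl | hne
    · rfl
    · refine (exitHeight_le_passHeight hXY.2.1 hne.symm).trans ?_
      rw [passHeight_comm hsym]
      exact L.passHeight_le_exitHeight hfin hXY.2.1 hXY.2.2 hne hXY.1

theorem exitHeight_ne_top (L : IsCycleLevel H q h E V) (hfin : ∀ x, h x ≠ ⊤)
    (hirr : ∀ x y, JoinedIn q Set.univ x y) {A B : Set α} (hA : A ∈ E) (hB : B ∈ E)
    (hAB : A ≠ B) : exitHeight q h E A ≠ ⊤ := by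
  obtain ⟨x, hx⟩ := L.nonempty A hA
  obtain ⟨y, hy⟩ := L.nonempty B hB
  obtain ⟨u, hu, v, hv, huv⟩ := (hirr x y).exists_edge hx
    (Set.disjoint_right.1 (L.disjoint hA hB hAB) hy)
  obtain ⟨C, hC, hvC⟩ := L.cover v
  have hAC : A ≠ C := by
    rintro rfl
    exact hv hvC
  exact ne_top_of_le_ne_top (max_lt (hfin u).lt_top (hfin v).lt_top).ne
    ((exitHeight_le_passHeight hC hAC).trans (passHeight_le h hu hvC huv))

theorem joinedIn_arrowClass (L : IsCycleLevel H q h E V) (hfin : ∀ x, h x ≠ ⊤)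
    (hirr : ∀ x y, JoinedIn q Set.univ x y) {A B : Set α} (hAB : arrowAux E V A B)
    (hBA : arrowAux E V B A) {x y : α} (hx : x ∈ A) (hy : y ∈ B) :
    JoinedIn q (arrowClass E V A) x y := by
  obtain ⟨hA, hgen⟩ := arrowAux_iff.1 hAB
  clear hAB
  induction hgen generalizing y with
  | refl =>
    exact ((L.isPathCycle A hA).isConnectedSet x hx y hy).mono
      (subset_arrowClass hA hBA hBA)
  | @tail X Y hX hXY ih =>
    have hXY' := arrowAux_of_VsAux_eq_zero hXY.2.1 hXY.2.2 hXY.1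
    have hAX : arrowAux E V A X := arrowAux_iff.2 ⟨hA, hX⟩
    have hXA := hXY'.trans hBA
    have hXsub := subset_arrowClass hXY.2.1 hAX hXA
    have hYsub := subset_arrowClass hXY.2.2 (hAX.trans hXY') hBA
    rcases eq_or_ne X Y with rfl | hne
    · exact ih hXA hy
    · obtain ⟨u, hu, v, hv, huv⟩ := exists_edge_of_passHeight_ne_top
        (ne_top_of_le_ne_top (L.exitHeight_ne_top hfin hirr hXY.2.1 hXY.2.2 hne)
          (L.passHeight_le_exitHeight hfin hXY.2.1 hXY.2.2 hne hXY.1))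
      exact ((ih hXA hu).trans (joinedIn_of_edge huv (hXsub hu) (hYsub hv))).trans
        (((L.isPathCycle Y hXY.2.2).isConnectedSet v hv y hy).mono hYsub)

theorem le_exitHeight (L : IsCycleLevel H q h E V) (hmono : ∀ x y, h x ≤ h y ↔ H x ≤ H y)
    {A : Set α} (hA : A ∈ E) {x : α} (hx : x ∈ A) : h x ≤ exitHeight q h E A :=
  le_iInf₂ fun _ hB => (L.isPathCycle A hA).le_passHeight hmono
    (L.disjoint hA hB.1 (Ne.symm hB.2)) hx

theorem isPathCycle_arrowClass (L : IsCycleLevel H q h E V)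
    (hmono : ∀ x y, h x ≤ h y ↔ H x ≤ H y) (hfin : ∀ x, h x ≠ ⊤)
    (hsym : ∀ x y, q x y = q y x) (hirr : ∀ x y, JoinedIn q Set.univ x y) {A : Set α}
    (hA : A ∈ E) (hmin : arrowClass E V A ∈ DstarAux E V) :
    IsPathCycle H q (arrowClass E V A) := by
  refine .inr ⟨(L.nonempty A hA).mono (subset_arrowClass hA (arrowAux_refl V hA)
    (arrowAux_refl V hA)), ?_, ?_⟩
  · rintro x ⟨B, ⟨-, hAB, hBA⟩, hx⟩ y ⟨C, ⟨-, hAC, hCA⟩, hy⟩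
    rw [arrowClass_congr hAB hBA]
    exact L.joinedIn_arrowClass hfin hirr (hBA.trans hAC) (hCA.trans hAB) hx hy
  · rintro x ⟨B, ⟨hB, hAB, hBA⟩, hx⟩ y ⟨hy, z, ⟨C, ⟨hC, hAC, hCA⟩, hz⟩, hzy⟩
    obtain ⟨D, hD, hyD⟩ := L.cover y
    have hnot : ¬ arrowAux E V C D := by
      intro hCD
      apply hy
      rw [← hmin.2 _ (arrowClass_mem_DAux hD)
        ⟨C, hC, D, hD, subset_arrowClass hC hAC hCA,
          subset_arrowClass hD (arrowAux_refl V hD) (arrowAux_refl V hD), hCD⟩]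
      exact subset_arrowClass hD (arrowAux_refl V hD) (arrowAux_refl V hD) hyD
    have hne : C ≠ D := by
      rintro rfl
      exact hnot (arrowAux_refl V hC)
    have hlt : exitHeight q h E C < max (h z) (h y) := by
      refine lt_of_lt_of_le ?_ (passHeight_le h hz hyD hzy)
      by_contra! hle
      refine hnot (arrowAux_of_VsAux_eq_zero hC hD ?_)
      rw [L.VsAux_eq hfin hC hD hne, tsub_eq_zero_of_le hle]
    have hy_lt : exitHeight q h E C < h y :=
      (lt_max_iff.1 hlt).resolve_left (L.le_exitHeight hmono hC hz).not_gt
    have hx_le : h x ≤ exitHeight q h E C :=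
      (L.le_exitHeight hmono hB hx).trans (L.exitHeight_anti hfin hsym (hCA.trans hAB))
    by_contra! hle
    exact ((hx_le.trans_lt hy_lt).trans_le ((hmono y x).2 hle)).false

/-- An element of the next level is a union of elements of `E` with a common exit height. -/
theorem EnextAux_structure (L : IsCycleLevel H q h E V) (hfin : ∀ x, h x ≠ ⊤)
    (hsym : ∀ x y, q x y = q y x) {A : Set α} (hA : A ∈ EnextAux E V) :
    (∀ x ∈ A, ∃ B ∈ E, B ⊆ A ∧ x ∈ B) ∧
      ∃ c, ∀ B ∈ E, B ⊆ A → exitHeight q h E B = c := by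
  rcases hA with ⟨⟨A, hA, rfl⟩, -⟩ | ⟨hA, -⟩
  · refine ⟨?_, exitHeight q h E A, fun B hB hBA => ?_⟩
    · rintro x ⟨B, ⟨hB, hAB, hBA⟩, hx⟩
      exact ⟨B, hB, subset_arrowClass hB hAB hBA, hx⟩
    · obtain ⟨h1, h2⟩ := L.arrowAux_of_subset_arrowClass hB hBA
      exact le_antisymm (L.exitHeight_anti hfin hsym h1) (L.exitHeight_anti hfin hsym h2)
  · refine ⟨fun x hx => ⟨A, hA, subset_rfl, hx⟩, exitHeight q h E A, fun B hB hBA => ?_⟩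
    rw [L.eq_of_subset hB hA hBA]

theorem nonempty_of_mem_EnextAux (L : IsCycleLevel H q h E V) {A : Set α}
    (hA : A ∈ EnextAux E V) : A.Nonempty := by
  rcases hA with ⟨⟨A, hA, rfl⟩, -⟩ | ⟨hA, -⟩
  · exact (L.nonempty A hA).mono (subset_arrowClass hA (arrowAux_refl V hA) (arrowAux_refl V hA))
  · exact L.nonempty A hA

theorem EnextAux_eq_of_mem (L : IsCycleLevel H q h E V) {A B : Set α}
    (hA : A ∈ EnextAux E V) (hB : B ∈ EnextAux E V) {x : α} (hxA : x ∈ A) (hxB : x ∈ B) :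
    A = B := by
  rcases hA with hA | ⟨hA, A', hA', hAA'⟩ <;> rcases hB with hB | ⟨hB, B', hB', hBB'⟩
  · exact L.DAux_eq_of_mem hA.1 hB.1 hxA hxB
  · obtain rfl := L.DAux_eq_of_mem hA.1 hB'.1 hxA (hBB' hxB)
    exact absurd hA hB'.2
  · obtain rfl := L.DAux_eq_of_mem hA'.1 hB.1 (hAA' hxA) hxB
    exact absurd hB hA'.2
  · exact L.eq_of_mem A hA B hB x hxA hxB

theorem HmAux_add_bottom (L : IsCycleLevel H q h E V) (hfin : ∀ x, h x ≠ ⊤) {A : Set α}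
    (hne : A.Nonempty) (hcover : ∀ x ∈ A, ∃ B ∈ E, B ⊆ A ∧ x ∈ B) {c : ℝ≥0∞}
    (hc : ∀ B ∈ E, B ⊆ A → exitHeight q h E B = c) : HmAux E V A + bottom h A = c := by
  apply le_antisymm
  · obtain ⟨x, hx⟩ := hne
    obtain ⟨B, hB, hBA, -⟩ := hcover x hx
    have hbot : bottom h A ≤ c := by
      rw [← hc B hB hBA, ← L.HeAux_add_bottom hB]
      exact le_add_left (biInf_mono fun _ hy => hBA hy)
    calc HmAux E V A + bottom h A ≤ (c - bottom h A) + bottom h A := by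
          gcongr
          refine iSup₂_le fun B hB => ?_
          refine ENNReal.le_sub_of_add_le_right (bottom_ne_top hfin ⟨x, hx⟩) ?_
          rw [← hc B hB.1 hB.2, ← L.HeAux_add_bottom hB.1]
          gcongr
          exact biInf_mono fun _ hy => hB.2 hy
      _ = c := tsub_add_cancel_of_le hbot
  · simp only [bottom, ENNReal.add_iInf]
    refine le_iInf₂ fun x hx => ?_
    obtain ⟨B, hB, hBA, hxB⟩ := hcover x hx
    rw [← hc B hB hBA, ← L.HeAux_add_bottom hB]
    exact add_le_add (le_iSup₂_of_le B ⟨hB, hBA⟩ le_rfl) (iInf₂_le x hxB)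

theorem VnextAux_add_bottom (L : IsCycleLevel H q h E V) (hfin : ∀ x, h x ≠ ⊤)
    (hsym : ∀ x y, q x y = q y x) {A B : Set α} (hA : A ∈ EnextAux E V)
    (hB : B ∈ EnextAux E V) (hAB : A ≠ B) :
    VnextAux E V A B + bottom h A = passHeight q h A B := by
  obtain ⟨hcovA, c, hc⟩ := L.EnextAux_structure hfin hsym hA
  have hcovB := (L.EnextAux_structure hfin hsym hB).1
  have hstep : ∀ X ∈ {X | X ∈ E ∧ X ⊆ A}, ∀ Y ∈ {Y | Y ∈ E ∧ Y ⊆ B},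
      c + VsAux E V X Y = passHeight q h X Y := by
    rintro X ⟨hX, hXA⟩ Y ⟨hY, hYB⟩
    have hXY : X ≠ Y := by
      rintro rfl
      obtain ⟨x, hx⟩ := L.nonempty X hX
      exact hAB (L.EnextAux_eq_of_mem hA hB (hXA hx) (hYB hx))
    rw [L.VsAux_eq hfin hX hY hXY, hc X hX hXA]
    refine add_tsub_cancel_of_le ?_
    rw [← hc X hX hXA]
    exact exitHeight_le_passHeight hY hXY
  rw [VnextAux, add_right_comm,
    L.HmAux_add_bottom hfin (L.nonempty_of_mem_EnextAux hA) hcovA hc]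
  simp only [ENNReal.add_iInf]
  rw [biInf_congr fun X hX => biInf_congr fun Y hY => hstep X hX Y hY]
  apply le_antisymm
  · refine MetropolisCycles.le_passHeight fun x hx y hy hxy => ?_
    obtain ⟨X, hX, hXA, hxX⟩ := hcovA x hx
    obtain ⟨Y, hY, hYB, hyY⟩ := hcovB y hy
    exact iInf₂_le_of_le X ⟨hX, hXA⟩ <| iInf₂_le_of_le Y ⟨hY, hYB⟩ <|
      passHeight_le h hxX hyY hxy
  · refine le_iInf₂ fun X hX => le_iInf₂ fun Y hY => ?_
    exact MetropolisCycles.le_passHeight fun x hx y hy hxy =>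
      passHeight_le h (hX.2 hx) (hY.2 hy) hxy

theorem next (L : IsCycleLevel H q h E V) (hmono : ∀ x y, h x ≤ h y ↔ H x ≤ H y)
    (hfin : ∀ x, h x ≠ ⊤) (hsym : ∀ x y, q x y = q y x)
    (hirr : ∀ x y, JoinedIn q Set.univ x y) :
    IsCycleLevel H q h (EnextAux E V) (VnextAux E V) where
  nonempty _ hA := L.nonempty_of_mem_EnextAux hA
  cover x := by
    obtain ⟨A, hA, hx⟩ := L.cover x
    have hsub := subset_arrowClass hA (arrowAux_refl V hA) (arrowAux_refl V hA)
    by_cases hmin : arrowClass E V A ∈ DstarAux E V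
    · exact ⟨_, .inl hmin, hsub hx⟩
    · exact ⟨A, .inr ⟨hA, _, ⟨arrowClass_mem_DAux hA, hmin⟩, hsub⟩, hx⟩
  eq_of_mem _ hA _ hB _ hxA hxB := L.EnextAux_eq_of_mem hA hB hxA hxB
  isPathCycle A hA := by
    rcases hA with hA | ⟨hA, -⟩
    · obtain ⟨A, hAE, rfl⟩ := hA.1
      exact L.isPathCycle_arrowClass hmono hfin hsym hirr hAE hA
    · exact L.isPathCycle A hA
  cost _ hA _ hB hAB := L.VnextAux_add_bottom hfin hsym hA hB hAB

/-- The level of singletons, with heights given by the energy shifted by a constant. -/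
theorem zero (H : α → ℝ) (q : α → α → ℝ) {K : ℝ} (hK : ∀ x, 0 ≤ H x + K) :
    IsCycleLevel H q (fun x => ENNReal.ofReal (H x + K)) {A | ∃ i, A = {i}} (V0 H q) where
  nonempty := by
    rintro _ ⟨i, rfl⟩
    exact Set.singleton_nonempty i
  cover x := ⟨{x}, ⟨x, rfl⟩, rfl⟩
  eq_of_mem := by
    rintro _ ⟨i, rfl⟩ _ ⟨j, rfl⟩ x rfl hx
    rw [Set.mem_singleton_iff.1 hx]
  isPathCycle _ hA := .inl hA
  cost := by
    rintro _ ⟨i, rfl⟩ _ ⟨j, rfl⟩ -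
    simp only [V0, bottom, passHeight, Set.mem_singleton_iff, iInf_iInf_eq_left,
      true_and, ENNReal.iInf_add]
    refine iInf_congr fun _ => ?_
    rcases le_total (H i) (H j) with hij | hij
    · rw [← ENNReal.ofReal_add (sub_nonneg.2 hij) (hK i),
        max_eq_right (ENNReal.ofReal_le_ofReal (by linarith))]
      congr 1
      ring
    · rw [ENNReal.ofReal_of_nonpos (sub_nonpos.2 hij), zero_add,
        max_eq_left (ENNReal.ofReal_le_ofReal (by linarith))]

end IsCycleLevel

end Level

/-- Every graph cycle is a path cycle. -/
theorem graphCycle_isPathCycle (H : S → ℝ) (q : S → S → ℝ)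
    (hq : ∀ x y : S, 0 ≤ q x y ∧ q x y ≤ 1)
    (hsum : ∀ x : S, ∑ y ∈ Finset.univ.erase x, q x y ≤ 1)
    (hsym : ∀ x y : S, q x y = q y x)
    (hirr : ∀ x y : S, JoinedIn q Set.univ x y)
    (A : Set S) (hA : A ∈ GraphCycles H q) :
    IsPathCycle H q A := by
  obtain ⟨K, hK⟩ : ∃ K : ℝ, ∀ x, 0 ≤ H x + K := by
    obtain ⟨m, hm⟩ := (Set.finite_range H).bddBelow
    exact ⟨-m, fun x => by linarith [hm (Set.mem_range_self x)]⟩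
  have hlevel : ∀ k, IsCycleLevel H q (fun x => ENNReal.ofReal (H x + K))
      (cycEV H q k).1 (cycEV H q k).2 := by
    intro k
    induction k with
    | zero => exact IsCycleLevel.zero H q hK
    | succ k ih =>
      exact ih.next (fun x y => by simp [ENNReal.ofReal_le_ofReal_iff (hK y)])
        (fun x => ENNReal.ofReal_ne_top) hsym hirr
  obtain ⟨k, hk⟩ := hA
  exact (hlevel k).isPathCycle A hk

end MetropolisCycles
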